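/- arXiv:1905.01350 — 2 statements merged into one kernel-verified Lean document; each statement's English description precedes it below -/
import Mathlib

section
/- For the Little model, fix x⁰, x¹ ∈ {0,1}^n, parameters θ = (w,b), and a direction v ∈ ℝ^{n×n} × ℝ^n with weight components v_{i,j} and bias components v_i. Then the derivative at λ = 0 of λ ↦ P_{θ+λv}(x⁰,x¹) equals P_θ(x⁰,x¹) · Σ_{i=1}^n (1 − σ((x¹_i)† u_i(x⁰,θ)))·(x¹_i)†·(Σ_{j=1}^n v_{i,j} x⁰_j + v_i), where x† = 2x − 1. -/
open Finset

/-- The logistic sigmoid `σ(x) = 1/(1+exp(−x))`. -/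
noncomputable def logistic (x : ℝ) : ℝ := 1 / (1 + Real.exp (-x))

/-- The input to node `i` at state `x`: `u_i(x,(w,b)) = ∑ j, w i j * x j + b i`. -/
noncomputable def nodeInput {n : ℕ} (w : Fin n → Fin n → ℝ) (b : Fin n → ℝ)
    (x : Fin n → Fin 2) (i : Fin n) : ℝ :=
  ∑ j, w i j * ((x j : ℕ) : ℝ) + b i

/-- The transition kernel of the Little model:
`P_θ(x⁰,x¹) = ∏ i, σ(u_i(x⁰,θ))^{x¹_i} (1 − σ(u_i(x⁰,θ)))^{1 − x¹_i}`. -/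
noncomputable def littleKernel {n : ℕ} (w : Fin n → Fin n → ℝ) (b : Fin n → ℝ)
    (x0 x1 : Fin n → Fin 2) : ℝ :=
  ∏ i, logistic (nodeInput w b x0 i) ^ ((x1 i : ℕ)) *
    (1 - logistic (nodeInput w b x0 i)) ^ (1 - (x1 i : ℕ))

theorem logistic_eq_sigmoid : logistic = Real.sigmoid := by
  funext x
  rw [logistic, Real.sigmoid_def, one_div]

theorem logistic_neg (x : ℝ) : logistic (-x) = 1 - logistic x := by
  simp only [logistic_eq_sigmoid, Real.sigmoid_neg]

theorem hasDerivAt_logistic (x : ℝ) :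
    HasDerivAt logistic (logistic x * (1 - logistic x)) x := by
  rw [logistic_eq_sigmoid]
  exact Real.hasDerivAt_sigmoid x

/-- The probability of a node's next state is the logistic function of its signed input. -/
theorem logistic_pow_mul_one_sub_logistic_pow (y : Fin 2) (u : ℝ) :
    logistic u ^ (y : ℕ) * (1 - logistic u) ^ (1 - (y : ℕ)) =
      logistic ((2 * ((y : ℕ) : ℝ) - 1) * u) := by
  fin_cases y
  · simp [logistic_neg]
  · norm_num

theorem littleKernel_eq_prod_logistic {n : ℕ} (w : Fin n → Fin n → ℝ) (b : Fin n → ℝ)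
    (x0 x1 : Fin n → Fin 2) :
    littleKernel w b x0 x1 =
      ∏ i, logistic ((2 * ((x1 i : ℕ) : ℝ) - 1) * nodeInput w b x0 i) :=
  prod_congr rfl fun _ _ => logistic_pow_mul_one_sub_logistic_pow _ _

theorem nodeInput_add_mul {n : ℕ} (w vw : Fin n → Fin n → ℝ) (b vb : Fin n → ℝ)
    (x : Fin n → Fin 2) (i : Fin n) (lam : ℝ) :
    nodeInput (fun i j => w i j + lam * vw i j) (fun i => b i + lam * vb i) x i =
      nodeInput w b x i + lam * nodeInput vw vb x i := by
  simp only [nodeInput, add_mul, sum_add_distrib, mul_add, mul_sum, mul_assoc]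
  ring

/-- The derivative of a product of logistic functions along a line. -/
theorem hasDerivAt_prod_logistic {ι : Type*} (s : Finset ι) (c u a : ι → ℝ) :
    HasDerivAt (fun lam : ℝ => ∏ i ∈ s, logistic (c i * (u i + lam * a i)))
      ((∏ i ∈ s, logistic (c i * u i)) * ∑ i ∈ s, (1 - logistic (c i * u i)) * c i * a i)
      0 := by
  classical
  have hfactor (i : ι) : HasDerivAt (fun lam : ℝ => logistic (c i * (u i + lam * a i)))
      (logistic (c i * u i) * ((1 - logistic (c i * u i)) * c i * a i)) 0 := by
    have hline : HasDerivAt (fun lam : ℝ => c i * (u i + lam * a i)) (c i * (1 * a i)) 0 :=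
      (((hasDerivAt_id (0 : ℝ)).mul_const (a i)).const_add (u i)).const_mul (c i)
    refine ((hasDerivAt_logistic _).comp 0 hline).congr_deriv ?_
    simp only [zero_mul, add_zero]
    ring
  refine (HasDerivAt.fun_finsetProd fun i (_ : i ∈ s) => hfactor i).congr_deriv ?_
  simp only [zero_mul, add_zero, smul_eq_mul, mul_sum]
  refine sum_congr rfl fun i hi => ?_
  rw [← mul_assoc, prod_erase_mul s _ hi]

/-- For the Little model, fix `x⁰, x¹ ∈ {0,1}^n`, parameters
`θ = (w,b)`, and a direction `v = (vw, vb) ∈ ℝ^{n×n} × ℝ^n`. Then the derivative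
at `λ = 0` of `λ ↦ P_{θ+λv}(x⁰,x¹)` equals
`P_θ(x⁰,x¹) · ∑ i, (1 − σ((x¹_i)† u_i(x⁰,θ)))·(x¹_i)†·(∑ j, vw i j x⁰_j + vb i)`,
where `x† = 2x − 1`. -/
theorem littleKernel_directional_derivative {n : ℕ}
    (w : Fin n → Fin n → ℝ) (b : Fin n → ℝ)
    (vw : Fin n → Fin n → ℝ) (vb : Fin n → ℝ)
    (x0 x1 : Fin n → Fin 2) :
    HasDerivAt
      (fun lam : ℝ =>
        littleKernel (fun i j => w i j + lam * vw i j) (fun i => b i + lam * vb i) x0 x1)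
      (littleKernel w b x0 x1 *
        ∑ i, (1 - logistic ((2 * ((x1 i : ℕ) : ℝ) - 1) * nodeInput w b x0 i)) *
          (2 * ((x1 i : ℕ) : ℝ) - 1) *
          (∑ j, vw i j * ((x0 j : ℕ) : ℝ) + vb i))
      0 := by
  simp only [littleKernel_eq_prod_logistic, nodeInput_add_mul]
  exact hasDerivAt_prod_logistic univ _ _ (nodeInput vw vb x0)
end

section
/- For the Little model, fix x⁰ ∈ {0,1}^n, parameters θ = (w,b), and a direction v ∈ ℝ^{n×n} × ℝ^n. Then Σ_{x¹∈{0,1}^n} P_θ(x⁰,x¹) · Σ_{i=1}^n [ x¹_i((v_i)_+ + Σ_{j=1}^n (v_{i,j})_+ x⁰_j) + σ(u_i(x⁰,θ))((v_i)_− + Σ_{j=1}^n (v_{i,j})_− x⁰_j) ] = Σ_{i=1}^n |v_i| σ(u_i(x⁰,θ)) + Σ_{i=1}^n Σ_{j=1}^n |v_{i,j}| x⁰_j σ(u_i(x⁰,θ)). In particular, if this common value c_{θ,v}(x⁰) is positive, then P⁺_{θ,v}(x⁰,·) defined by P⁺_{θ,v}(x⁰,x¹) = (P_θ(x⁰,x¹)/c_{θ,v}(x⁰))·Σ_{i=1}^n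 [ x¹_i((v_i)_+ + Σ_j (v_{i,j})_+ x⁰_j) + σ(u_i(x⁰,θ))((v_i)_− + Σ_j (v_{i,j})_− x⁰_j) ] is a probability distribution on {0,1}^n. -/
open Finset

/-- The normalizing constant
`c_{θ,v}(x⁰) = ∑ i, |v_i| σ(u_i(x⁰,θ)) + ∑ i, ∑ j, |v_{i,j}| x⁰_j σ(u_i(x⁰,θ))`. -/
noncomputable def cLittle {n : ℕ} (w : Fin n → Fin n → ℝ) (b : Fin n → ℝ)
    (vw : Fin n → Fin n → ℝ) (vb : Fin n → ℝ) (x0 : Fin n → Fin 2) : ℝ :=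
  ∑ i, |vb i| * logistic (nodeInput w b x0 i) +
    ∑ i, ∑ j, |vw i j| * ((x0 j : ℕ) : ℝ) * logistic (nodeInput w b x0 i)

/-- The "positive" kernel `P⁺_{θ,v}(x⁰,x¹)` of the measure-valued directional
derivative of the Little model. -/
noncomputable def PplusLittle {n : ℕ} (w : Fin n → Fin n → ℝ) (b : Fin n → ℝ)
    (vw : Fin n → Fin n → ℝ) (vb : Fin n → ℝ) (x0 x1 : Fin n → Fin 2) : ℝ :=
  (littleKernel w b x0 x1 / cLittle w b vw vb x0) *
    ∑ i, (((x1 i : ℕ) : ℝ) * (max 0 (vb i) + ∑ j, max 0 (vw i j) * ((x0 j : ℕ) : ℝ)) +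
      logistic (nodeInput w b x0 i) *
        (max 0 (-(vb i)) + ∑ j, max 0 (-(vw i j)) * ((x0 j : ℕ) : ℝ)))

theorem logistic_pos (x : ℝ) : 0 < logistic x := by
  unfold logistic
  positivity

theorem logistic_lt_one (x : ℝ) : logistic x < 1 := by
  unfold logistic
  rw [div_lt_one (by positivity)]
  linarith [Real.exp_pos (-x)]

theorem littleKernel_nonneg {n : ℕ} (w : Fin n → Fin n → ℝ) (b : Fin n → ℝ)
    (x0 x1 : Fin n → Fin 2) : 0 ≤ littleKernel w b x0 x1 :=
  Finset.prod_nonneg fun _ _ => mul_nonneg (pow_nonneg (logistic_pos _).le _)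
    (pow_nonneg (sub_nonneg.2 (logistic_lt_one _).le) _)

/-- A product of Bernoulli weights has total mass one. -/
theorem sum_littleKernel {n : ℕ} (w : Fin n → Fin n → ℝ) (b : Fin n → ℝ)
    (x0 : Fin n → Fin 2) : ∑ x1, littleKernel w b x0 x1 = 1 := by
  unfold littleKernel
  rw [← Fintype.prod_sum fun i (a : Fin 2) => logistic (nodeInput w b x0 i) ^ (a : ℕ) *
    (1 - logistic (nodeInput w b x0 i)) ^ (1 - (a : ℕ))]
  simp [Fin.sum_univ_two]

/-- Node `i` fires with probability `σ(u_i(x⁰,θ))`. -/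
theorem sum_littleKernel_mul_apply {n : ℕ} (w : Fin n → Fin n → ℝ) (b : Fin n → ℝ)
    (x0 : Fin n → Fin 2) (i : Fin n) :
    ∑ x1, littleKernel w b x0 x1 * ((x1 i : ℕ) : ℝ) = logistic (nodeInput w b x0 i) := by
  have h (x1 : Fin n → Fin 2) : littleKernel w b x0 x1 * ((x1 i : ℕ) : ℝ) =
      ∏ k, logistic (nodeInput w b x0 k) ^ (x1 k : ℕ) *
        (1 - logistic (nodeInput w b x0 k)) ^ (1 - (x1 k : ℕ)) *
        (if k = i then ((x1 k : ℕ) : ℝ) else 1) := by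
    rw [Finset.prod_mul_distrib, Finset.prod_ite_eq' Finset.univ i fun k => ((x1 k : ℕ) : ℝ)]
    simp [littleKernel]
  simp_rw [h]
  rw [← Fintype.prod_sum fun k (a : Fin 2) => logistic (nodeInput w b x0 k) ^ (a : ℕ) *
    (1 - logistic (nodeInput w b x0 k)) ^ (1 - (a : ℕ)) *
    (if k = i then ((a : ℕ) : ℝ) else 1)]
  rw [Finset.prod_eq_single i]
  · simp [Fin.sum_univ_two]
  · intro k _ hk
    simp [Fin.sum_univ_two, hk]
  · simp

theorem max_zero_add_max_zero_neg (a : ℝ) : max 0 a + max 0 (-a) = |a| := by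
  rcases le_total 0 a with h | h
  · simp [h, abs_of_nonneg h]
  · simp [h, abs_of_nonpos h]

theorem sum_littleKernel_mul_affine {n : ℕ} (w : Fin n → Fin n → ℝ) (b : Fin n → ℝ)
    (x0 : Fin n → Fin 2) (p q : Fin n → ℝ) :
    ∑ x1 : Fin n → Fin 2, littleKernel w b x0 x1 *
        ∑ i, (((x1 i : ℕ) : ℝ) * p i + logistic (nodeInput w b x0 i) * q i)
      = ∑ i, logistic (nodeInput w b x0 i) * (p i + q i) := by
  simp_rw [Finset.mul_sum]
  rw [Finset.sum_comm]
  simp_rw [mul_add, ← mul_assoc, Finset.sum_add_distrib, ← Finset.sum_mul,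
    sum_littleKernel_mul_apply, sum_littleKernel, one_mul]

theorem sum_littleKernel_mul_weight {n : ℕ} (w : Fin n → Fin n → ℝ) (b : Fin n → ℝ)
    (vw : Fin n → Fin n → ℝ) (vb : Fin n → ℝ) (x0 : Fin n → Fin 2) :
    ∑ x1 : Fin n → Fin 2, littleKernel w b x0 x1 *
        ∑ i, (((x1 i : ℕ) : ℝ) * (max 0 (vb i) + ∑ j, max 0 (vw i j) * ((x0 j : ℕ) : ℝ)) +
          logistic (nodeInput w b x0 i) *
            (max 0 (-(vb i)) + ∑ j, max 0 (-(vw i j)) * ((x0 j : ℕ) : ℝ)))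
      = cLittle w b vw vb x0 := by
  rw [sum_littleKernel_mul_affine w b x0
    (fun i => max 0 (vb i) + ∑ j, max 0 (vw i j) * ((x0 j : ℕ) : ℝ))
    (fun i => max 0 (-(vb i)) + ∑ j, max 0 (-(vw i j)) * ((x0 j : ℕ) : ℝ))]
  rw [cLittle, ← Finset.sum_add_distrib]
  refine Finset.sum_congr rfl fun i _ => ?_
  simp_rw [← max_zero_add_max_zero_neg, ← Finset.sum_mul, add_mul, Finset.sum_add_distrib]
  ring

/-- For the Little model, fix `x⁰`, parameters `θ = (w,b)` and
a direction `v = (vw, vb)`. Then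
`∑ x¹, P_θ(x⁰,x¹)·∑ i [x¹_i((v_i)_+ + ∑ j (v_{i,j})_+ x⁰_j) + σ(u_i(x⁰,θ))((v_i)_− + ∑ j (v_{i,j})_− x⁰_j)]
 = ∑ i |v_i| σ(u_i(x⁰,θ)) + ∑ i ∑ j |v_{i,j}| x⁰_j σ(u_i(x⁰,θ)) = c_{θ,v}(x⁰)`.
In particular, if `c_{θ,v}(x⁰) > 0` then `P⁺_{θ,v}(x⁰,·)` is a probability
distribution on `{0,1}^n`. -/
theorem littleKernel_cplus_normalization {n : ℕ}
    (w : Fin n → Fin n → ℝ) (b : Fin n → ℝ)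
    (vw : Fin n → Fin n → ℝ) (vb : Fin n → ℝ)
    (x0 : Fin n → Fin 2) :
    (∑ x1 : Fin n → Fin 2, littleKernel w b x0 x1 *
        ∑ i, (((x1 i : ℕ) : ℝ) * (max 0 (vb i) + ∑ j, max 0 (vw i j) * ((x0 j : ℕ) : ℝ)) +
          logistic (nodeInput w b x0 i) *
            (max 0 (-(vb i)) + ∑ j, max 0 (-(vw i j)) * ((x0 j : ℕ) : ℝ)))
      = cLittle w b vw vb x0) ∧
    (0 < cLittle w b vw vb x0 →
      (∀ x1, 0 ≤ PplusLittle w b vw vb x0 x1) ∧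
        ∑ x1 : Fin n → Fin 2, PplusLittle w b vw vb x0 x1 = 1) := by
  refine ⟨sum_littleKernel_mul_weight w b vw vb x0, fun hc => ⟨fun x1 => ?_, ?_⟩⟩
  · have := littleKernel_nonneg w b x0 x1
    have h (i : Fin n) := (logistic_pos (nodeInput w b x0 i)).le
    refine mul_nonneg (div_nonneg this hc.le) (Finset.sum_nonneg fun i _ => ?_)
    have (a : Fin n → ℝ) : 0 ≤ ∑ j, max 0 (a j) * ((x0 j : ℕ) : ℝ) :=
      Finset.sum_nonneg fun j _ => by positivity
    exact add_nonneg
      (mul_nonneg (Nat.cast_nonneg _) (add_nonneg (le_max_left _ _) (this _)))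
      (mul_nonneg (h i) (add_nonneg (le_max_left _ _) (this fun j => -(vw i j))))
  · simp_rw [PplusLittle, div_mul_eq_mul_div, ← Finset.sum_div]
    rw [sum_littleKernel_mul_weight, div_self hc.ne']
end
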